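/- arXiv:2206.10374 — 2 statements merged into one kernel-verified Lean document; each statement's English description precedes it below -/
import Mathlib

section
/- (Sufficient condition) Let n ≥ 2 and let d, t : Fin n → ℝ be tuples of nonnegative real numbers such that d 0 = t 0 and, for every integer m with 1 ≤ m ≤ n − 1, ∑_{i} (d i)^(2m) = ∑_{i} (t i)^(2m). Then there exists a permutation σ of Fin n such that t i = d (σ i) for all i; in particular the multisets {d i} and {t i} coincide. -/
theorem aux_esymm (k : ℕ) (x y : Fin k → ℝ)
    (h : ∀ m : ℕ, 1 ≤ m → m ≤ k → ∑ i, x i ^ m = ∑ i, y i ^ m) (j : ℕ) (hj : j ≤ k) :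
    MvPolynomial.aeval x (MvPolynomial.esymm (Fin k) ℝ j) =
      MvPolynomial.aeval y (MvPolynomial.esymm (Fin k) ℝ j) := by
  induction j using Nat.strong_induction_on with
  | _ j ih =>
    rcases Nat.eq_zero_or_pos j with rfl | hpos
    · simp
    have hx := congrArg (MvPolynomial.aeval x) (MvPolynomial.mul_esymm_eq_sum (Fin k) ℝ j)
    have hy := congrArg (MvPolynomial.aeval y) (MvPolynomial.mul_esymm_eq_sum (Fin k) ℝ j)
    simp only [map_mul, map_natCast, map_pow, map_neg, map_one, map_sum] at hx hy
    have hne : (j : ℝ) ≠ 0 := by positivity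
    apply mul_left_cancel₀ hne
    rw [hx, hy]
    congr 1
    apply Finset.sum_congr rfl
    intro a ha
    rw [Finset.mem_filter] at ha
    have hs : a.1 + a.2 = j := Finset.HasAntidiagonal.mem_antidiagonal.1 ha.1
    rw [ih a.1 ha.2 (by omega)]
    congr 1
    simp only [MvPolynomial.psum, map_sum, map_pow, MvPolynomial.aeval_X]
    exact h a.2 (by omega) (by omega)

theorem aux_multiset (k : ℕ) (x y : Fin k → ℝ)
    (h : ∀ m : ℕ, 1 ≤ m → m ≤ k → ∑ i, x i ^ m = ∑ i, y i ^ m) :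
    (Finset.univ.val.map x : Multiset ℝ) = Finset.univ.val.map y := by
  rw [← Polynomial.roots_multiset_prod_X_sub_C (Finset.univ.val.map x),
    ← Polynomial.roots_multiset_prod_X_sub_C (Finset.univ.val.map y),
    Multiset.prod_X_sub_X_eq_sum_esymm, Multiset.prod_X_sub_X_eq_sum_esymm]
  congr 1
  simp only [Multiset.card_map, Finset.card_val, Finset.card_univ, Fintype.card_fin]
  apply Finset.sum_congr rfl
  intro j hj
  have := aux_esymm k x y h j (by simpa [Nat.lt_succ_iff] using hj)
  rw [MvPolynomial.aeval_esymm_eq_multiset_esymm, MvPolynomial.aeval_esymm_eq_multiset_esymm] at this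
  rw [this]

theorem aux_perm (k : ℕ) (x y : Fin k → ℝ)
    (h : (Finset.univ.val.map x : Multiset ℝ) = Finset.univ.val.map y) :
    ∃ σ : Equiv.Perm (Fin k), ∀ i, y i = x (σ i) := by
  have hs : x ∘ Tuple.sort x = y ∘ Tuple.sort y := by
    apply List.ofFn_injective
    apply List.Perm.eq_of_sortedLE (Tuple.monotone_sort x).sortedLE_ofFn
      (Tuple.monotone_sort y).sortedLE_ofFn
    refine (Equiv.Perm.ofFn_comp_perm _ _).trans (.trans ?_ (Equiv.Perm.ofFn_comp_perm _ _).symm)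
    rw [← Multiset.coe_eq_coe]
    simpa [Fin.univ_val_map] using h
  refine ⟨(Tuple.sort y).symm.trans (Tuple.sort x), fun i => ?_⟩
  have := congrFun hs ((Tuple.sort y).symm i)
  simpa using this.symm

/-- Sufficient condition: if two nonnegative tuples of length `n ≥ 2` have one matched entry
and equal `(2m)`-th power sums for `m = 1, …, n-1`, then they agree up to a permutation. -/
theorem stmt_5 (n : ℕ) (hn : 2 ≤ n) (d t : Fin n → ℝ)
    (hd : ∀ i, 0 ≤ d i) (ht : ∀ i, 0 ≤ t i)
    (h0 : d ⟨0, by omega⟩ = t ⟨0, by omega⟩)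
    (hpow : ∀ m : ℕ, 1 ≤ m → m ≤ n - 1 →
      ∑ i, d i ^ (2 * m) = ∑ i, t i ^ (2 * m)) :
    ∃ σ : Equiv.Perm (Fin n), ∀ i, t i = d (σ i) := by
  obtain ⟨k, rfl⟩ : ∃ k, n = k + 1 := ⟨n - 1, by omega⟩
  replace h0 : d 0 = t 0 := h0
  obtain ⟨σ, hσ⟩ := aux_perm k _ _ (aux_multiset k (fun i => d i.succ ^ 2) (fun i => t i.succ ^ 2) (by
    intro m h1 h2
    have := hpow m h1 (by omega)
    rw [Fin.sum_univ_succ, Fin.sum_univ_succ, h0] at this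
    simpa [← pow_mul] using this))
  refine ⟨Equiv.Perm.decomposeFin.symm (0, σ), fun i => ?_⟩
  refine Fin.cases ?_ (fun j => ?_) i
  · simp [h0]
  · simpa using (pow_left_inj₀ (ht _) (hd _) two_ne_zero).1 (hσ j)
end

section
/- (Generalized Bottema theorem) Let P, Q, a ∈ ℂ and let O₁, O₂ ∈ ℂ satisfy P = O₁ + (a − O₁)·ζ^(−1) and Q = O₂ + (a − O₂)·ζ (so that O₁, O₂ are the centers of the regular n-gons A₁A₂⋯A_n and A₁B₂⋯B_n of opposite orientations erected on the sides aP and aQ, with A₁ = B₁ = a, A_n = P, B_n = Q). Then the midpoint of D₁ = 2O₁ − a and D₂ = 2O₂ − a equals (ζ·P − Q)/(ζ − 1); in particular it does not depend on a. -/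
/-- Generalized Bottema theorem: erect regular `n`-gons of opposite orientations with shared
vertex `a` on the sides `aP` and `aQ` (so `A_n = P`, `B_n = Q`); then the midpoint of the two
points of the circumcircles diametrically opposite `a` equals `(ζ·P - Q)/(ζ - 1)`, which is
independent of `a`. -/
theorem stmt_17 (n : ℕ) (hn : 3 ≤ n) (ζ : ℂ)
    (hζ : ζ = Complex.exp (2 * Real.pi * Complex.I / n))
    (P Q a O₁ O₂ : ℂ)
    (hP : P = O₁ + (a - O₁) * ζ⁻¹) (hQ : Q = O₂ + (a - O₂) * ζ)
    (D₁ D₂ : ℂ) (hD₁ : D₁ = 2 * O₁ - a) (hD₂ : D₂ = 2 * O₂ - a) :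
    midpoint ℝ D₁ D₂ = (ζ * P - Q) / (ζ - 1) := by
  have h0 : ζ ≠ 0 := by rw [hζ]; exact Complex.exp_ne_zero _
  have h1 : ζ ≠ 1 := by
    rw [hζ]
    exact (Complex.isPrimitiveRoot_exp n (by omega)).ne_one (by omega)
  have h2 : ζ - 1 ≠ 0 := sub_ne_zero.mpr h1
  have hm : midpoint ℝ D₁ D₂ = O₁ + O₂ - a := by
    rw [midpoint_eq_smul_add, hD₁, hD₂, Complex.real_smul]
    simp
    ring
  have hzP : ζ * P = ζ * O₁ + (a - O₁) := by
    rw [hP]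
    field_simp
  rw [hm, eq_div_iff h2, hzP, hQ]
  ring
end
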